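/- arXiv:1901.07502 — 2 statements merged into one kernel-verified Lean document; each statement's English description precedes it below -/
import Mathlib

section
/- Let w1, w2, w3, w4 be binary words of equal length ℓ (so the circular word w = w1w2w3w4 has length n = 4ℓ). Then there exist words p and q with 3·(|p| + |q|) ≥ 4ℓ (equivalently, the palindromes p·p^R and q·q^R have total length at least 2n/3) such that p is a subsequence of w1·w2, the reversal of p is a subsequence of w3·w4, q is a subsequence of w2·w3, and the reversal of q is a subsequence of w4·w1. -/
/-- `p` is a subsequence of `u` whose reversal is a subsequence of `v`. -/
def IsFoldedSublist (p u v : List (Fin 2)) : Prop :=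
  p.Sublist u ∧ p.reverse.Sublist v

theorem isFoldedSublist_replicate (c : Fin 2) (u v : List (Fin 2)) :
    IsFoldedSublist (List.replicate (min (u.count c) (v.count c)) c) u v := by
  simp [IsFoldedSublist, List.replicate_sublist_iff]

theorem IsFoldedSublist.append {p q u u' v v' : List (Fin 2)} (hp : IsFoldedSublist p u v')
    (hq : IsFoldedSublist q u' v) : IsFoldedSublist (p ++ q) (u ++ u') (v ++ v') := by
  refine ⟨hp.1.append hq.1, ?_⟩
  rw [List.reverse_append]
  exact hq.2.append hp.2

theorem exists_isFoldedSublist_max {u v : List (Fin 2)} {a b : ℕ}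
    (ha : ∃ p, IsFoldedSublist p u v ∧ a ≤ p.length)
    (hb : ∃ p, IsFoldedSublist p u v ∧ b ≤ p.length) :
    ∃ p, IsFoldedSublist p u v ∧ max a b ≤ p.length := by
  rcases max_choice a b with h | h <;> rw [h] <;> assumption

theorem exists_isFoldedSublist_max_count (u v : List (Fin 2)) :
    ∃ p, IsFoldedSublist p u v ∧
      max (min (u.count 0) (v.count 0)) (min (u.count 1) (v.count 1)) ≤ p.length :=
  exists_isFoldedSublist_max ⟨_, isFoldedSublist_replicate 0 u v, by simp⟩
    ⟨_, isFoldedSublist_replicate 1 u v, by simp⟩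

/-- A folded sublist of `u ++ v` and `x ++ y` at least as long as both the best constant one and
the concatenation of the best constant ones for the pairs `u, y` and `v, x`. -/
theorem exists_isFoldedSublist_append (u v x y : List (Fin 2)) :
    ∃ p, IsFoldedSublist p (u ++ v) (x ++ y) ∧
      max (max (min (u.count 0 + v.count 0) (x.count 0 + y.count 0))
          (min (u.count 1 + v.count 1) (x.count 1 + y.count 1)))
        (max (min (u.count 0) (y.count 0)) (min (u.count 1) (y.count 1)) +
          max (min (v.count 0) (x.count 0)) (min (v.count 1) (x.count 1))) ≤ p.length := by
  apply exists_isFoldedSublist_max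
  · simpa only [List.count_append] using exists_isFoldedSublist_max_count (u ++ v) (x ++ y)
  · obtain ⟨p, hp, hpl⟩ := exists_isFoldedSublist_max_count u y
    obtain ⟨q, hq, hql⟩ := exists_isFoldedSublist_max_count v x
    exact ⟨p ++ q, hp.append hq, by rw [List.length_append]; omega⟩

theorem count_zero_add_count_one (w : List (Fin 2)) : w.count 0 + w.count 1 = w.length := by
  induction w with
  | nil => rfl
  | cons a w ih => fin_cases a <;> simp <;> omega

/-- When `a + a' = b + b'`, the two minima `min a b` and `min a' b'` are attained on opposite
sides. -/
theorem le_max_min_of_add_eq_add {a a' b b' m : ℕ} (h : a + a' = b + b')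
    (hm : max (min a b) (min a' b') ≤ m) : (a ≤ m ∧ b' ≤ m) ∨ (b ≤ m ∧ a' ≤ m) := by
  omega

/-- For binary words `w1, w2, w3, w4` of equal length `ℓ` (representing a
circular word of length `n = 4ℓ`), there are words `p` and `q` with
`3 * (|p| + |q|) ≥ 4 * ℓ` (so the palindromes `p ++ p.reverse` and `q ++ q.reverse` have total
length at least `2n / 3`) such that `p` is a subsequence of `w1 ++ w2`, `p.reverse` of
`w3 ++ w4`, `q` of `w2 ++ w3`, and `q.reverse` of `w4 ++ w1`. -/
theorem two_cuts_palindromes_total_bound (ℓ : ℕ) (w1 w2 w3 w4 : List (Fin 2))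
    (h1 : w1.length = ℓ) (h2 : w2.length = ℓ) (h3 : w3.length = ℓ) (h4 : w4.length = ℓ) :
    ∃ p q : List (Fin 2), 3 * (p.length + q.length) ≥ 4 * ℓ ∧
      p.Sublist (w1 ++ w2) ∧ p.reverse.Sublist (w3 ++ w4) ∧
      q.Sublist (w2 ++ w3) ∧ q.reverse.Sublist (w4 ++ w1) := by
  obtain ⟨p, hp, hpl⟩ := exists_isFoldedSublist_append w1 w2 w3 w4
  obtain ⟨q, hq, hql⟩ := exists_isFoldedSublist_append w2 w3 w4 w1
  refine ⟨p, q, ?_, hp.1, hp.2, hq.1, hq.2⟩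
  have e1 := (count_zero_add_count_one w1).trans h1
  have e2 := (count_zero_add_count_one w2).trans h2
  have e3 := (count_zero_add_count_one w3).trans h3
  have e4 := (count_zero_add_count_one w4).trans h4
  rw [max_le_iff] at hpl hql
  obtain ⟨hps, hpm⟩ := hpl
  obtain ⟨hqs, hqm⟩ := hql
  generalize hm12 : max (min (w2.count 0) (w1.count 0)) (min (w2.count 1) (w1.count 1)) = m12 at hqm
  generalize hm23 : max (min (w2.count 0) (w3.count 0)) (min (w2.count 1) (w3.count 1)) = m23 at hpm
  generalize hm34 : max (min (w3.count 0) (w4.count 0)) (min (w3.count 1) (w4.count 1)) = m34 at hqm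
  generalize hm14 : max (min (w1.count 0) (w4.count 0)) (min (w1.count 1) (w4.count 1)) = m14 at hpm
  replace hm12 := le_max_min_of_add_eq_add (by omega) hm12.le
  replace hm23 := le_max_min_of_add_eq_add (by omega) hm23.le
  replace hm34 := le_max_min_of_add_eq_add (by omega) hm34.le
  replace hm14 := le_max_min_of_add_eq_add (by omega) hm14.le
  replace hps := le_max_min_of_add_eq_add (by omega) hps
  replace hqs := le_max_min_of_add_eq_add (by omega) hqs
  rcases hps with hps | hps <;> rcases hqs with hqs | hqs <;>
    rcases hm12 with hm12 | hm12 <;> rcases hm23 with hm23 | hm23 <;>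
    rcases hm34 with hm34 | hm34 <;> rcases hm14 with hm14 | hm14 <;> omega
end

section
/- For every integer k ≥ 2 and every real ε > 0, there exist a positive integer n and a word w over the alphabet {0,…,k−1} of length k·n in which every letter occurs exactly n times, such that for every rotation u of w, every subsequence v of u that is a palindrome satisfies |v| ≤ (2/(k+1) + ε)·k·n. -/
open scoped List

/-- The word whose letters are those at positions `s, …, s + m - 1` of the infinite periodic word
`0ᵃ1ᵃ⋯(k-1)ᵃ0ᵃ1ᵃ⋯`. -/
def blockWord (k a s m : ℕ) : List ℕ := (List.range' s m).map fun p => p / a % k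

/-- In every factor of `v`, each letter has frequency at most `1 / k`, up to an error of `a`
occurrences. -/
def LetterBalanced (k a : ℕ) (v : List ℕ) : Prop :=
  ∀ (c : ℕ) (q : List ℕ), q <:+: v → k * q.count c ≤ q.length + k * a

/-- Every common subsequence of a factor `p` of `u` and of an `a`-balanced word `v` has length at
most `|v| / k`, up to an error of `a` for each of at most `|p| / b + 2` runs. -/
def Coarse (k b : ℕ) (u : List ℕ) : Prop :=
  ∀ (a : ℕ) (p v x : List ℕ), p <:+: u → LetterBalanced k a v → x <+ p → x <+ v →
    b * (k * x.length) ≤ b * v.length + k * a * (p.length + 2 * b)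

theorem length_blockWord (k a s m : ℕ) : (blockWord k a s m).length = m := by
  simp [blockWord]

theorem blockWord_add (k a s m n : ℕ) :
    blockWord k a s (m + n) = blockWord k a s m ++ blockWord k a (s + m) n := by
  simp [blockWord, ← List.map_append, List.range'_append_1]

theorem blockWord_eq_append {k a s m : ℕ} {x y : List ℕ} (h : blockWord k a s m = x ++ y) :
    ∃ j ≤ m, x = blockWord k a s j ∧ y = blockWord k a (s + j) (m - j) := by
  obtain ⟨x', y', h', rfl, rfl⟩ := List.map_eq_append_iff.1 h
  obtain ⟨j, hj, rfl, rfl⟩ := List.range'_eq_append_iff.1 h'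
  exact ⟨j, hj, rfl, by simp [blockWord]⟩

theorem exists_eq_blockWord_of_isInfix {k a s m : ℕ} {q : List ℕ} (h : q <:+: blockWord k a s m) :
    ∃ s' m', q = blockWord k a s' m' := by
  obtain ⟨x, y, h⟩ := h
  obtain ⟨j, -, hx, -⟩ := blockWord_eq_append h.symm
  obtain ⟨i, -, -, hq⟩ := blockWord_eq_append hx.symm
  exact ⟨_, _, hq⟩

theorem blockWord_eq_replicate {k a s m : ℕ} (h : s % a + m ≤ a) :
    blockWord k a s m = List.replicate m (s / a % k) := by
  rw [blockWord, List.eq_replicate_iff]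
  refine ⟨by simp, ?_⟩
  simp only [List.mem_map, List.mem_range'_1, forall_exists_index, and_imp]
  rintro _ p hs hp rfl
  have hd := Nat.div_add_mod s a
  have : p / a = s / a := by
    rw [Nat.div_eq_iff (by omega)]
    constructor
    · rw [Nat.mul_comm]; omega
    · rw [Nat.mul_comm]; omega
  rw [this]

theorem count_blockWord_zero {k a c : ℕ} (ha : 0 < a) (j : ℕ) (hj : j ≤ k) :
    (blockWord k a 0 (j * a)).count c = if c < j then a else 0 := by
  induction j with
  | zero => simp [blockWord]
  | succ j ih =>
    rw [Nat.succ_mul, blockWord_add, List.count_append, ih (by omega),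
      blockWord_eq_replicate (by simp), List.count_replicate]
    simp only [Nat.zero_add, Nat.mul_div_cancel _ ha, Nat.mod_eq_of_lt (show j < k by omega),
      beq_iff_eq]
    split_ifs <;> omega

theorem count_blockWord_period {k a c : ℕ} (ha : 0 < a) (s : ℕ) :
    (blockWord k a s (k * a)).count c = if c < k then a else 0 := by
  induction s with
  | zero => exact count_blockWord_zero ha k le_rfl
  | succ s ih =>
    rw [← ih]
    have h1 := congrArg (List.count c) (blockWord_add k a s (k * a) 1)
    have h2 := congrArg (List.count c) (blockWord_add k a s 1 (k * a))
    rw [Nat.add_comm 1] at h2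
    rw [h2, List.count_append, List.count_append] at h1
    have h3 : blockWord k a (s + k * a) 1 = blockWord k a s 1 := by
      simp [blockWord, Nat.add_mul_div_right _ _ ha]
    rw [h3] at h1
    omega

theorem count_blockWord_mul {k a c : ℕ} (ha : 0 < a) (s q : ℕ) :
    (blockWord k a s (k * a * q)).count c = if c < k then a * q else 0 := by
  induction q with
  | zero => simp [blockWord]
  | succ q ih =>
    rw [Nat.mul_succ, blockWord_add, List.count_append, ih, count_blockWord_period ha]
    split_ifs <;> ring

theorem letterBalanced_blockWord {k a : ℕ} (hk : 0 < k) (ha : 0 < a) (s m : ℕ) :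
    LetterBalanced k a (blockWord k a s m) := by
  intro c q hq
  obtain ⟨s, m, rfl⟩ := exists_eq_blockWord_of_isInfix hq
  rw [length_blockWord]
  have hm := Nat.div_add_mod m (k * a)
  have hr := Nat.mod_lt m (Nat.mul_pos hk ha)
  generalize m / (k * a) = d at hm
  generalize m % (k * a) = r at hm hr
  subst hm
  obtain ⟨e, he⟩ := Nat.exists_eq_add_of_le hr.le
  rw [blockWord_add, List.count_append, count_blockWord_mul ha]
  generalize s + k * a * d = s'
  have h1 := count_blockWord_period (k := k) (c := c) ha s'
  rw [he, blockWord_add, List.count_append] at h1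
  have h2 : (if c < k then a * d else 0) ≤ a * d := by split_ifs <;> simp
  have h3 : (if c < k then a else 0) ≤ a := by split_ifs <;> simp
  calc k * _ ≤ k * (a * d + a) := Nat.mul_le_mul_left _ (by omega)
    _ = k * a * d + k * a := by ring
    _ ≤ _ := by omega

theorem LetterBalanced.factor {k a : ℕ} {u v : List ℕ} (h : LetterBalanced k a v) (huv : u <:+: v) :
    LetterBalanced k a u :=
  fun c q hq => h c q (hq.trans huv)

theorem LetterBalanced.reverse {k a : ℕ} {v : List ℕ} (h : LetterBalanced k a v) :
    LetterBalanced k a v.reverse := by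
  intro c q hq
  simpa using h c q.reverse (by simpa using List.reverse_infix.2 hq)

theorem Coarse.factor {k b : ℕ} {u v : List ℕ} (h : Coarse k b v) (huv : u <:+: v) : Coarse k b u :=
  fun a p w x hp => h a p w x (hp.trans huv)

theorem Coarse.reverse {k b : ℕ} {u : List ℕ} (h : Coarse k b u) : Coarse k b u.reverse := by
  intro a p v x hp hv hxp hxv
  simpa using h a p.reverse v.reverse x.reverse (by simpa using List.reverse_infix.2 hp) hv.reverse
    hxp.reverse hxv.reverse

theorem LetterBalanced.length_le_of_sublist_replicate {k a m c : ℕ} {v x : List ℕ}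
    (hv : LetterBalanced k a v)
    (hx : x <+ List.replicate m c) (hxv : x <+ v) : k * x.length ≤ v.length + k * a := by
  obtain ⟨n, -, rfl⟩ := List.sublist_replicate_iff.1 hx
  have := hxv.count_le c
  rw [List.count_replicate_self] at this
  rw [List.length_replicate]
  exact (Nat.mul_le_mul_left k this).trans (hv c v List.infix_rfl)

theorem length_le_of_sublist_blockWord {k a b : ℕ} (hb : 0 < b) (m : ℕ) :
    ∀ (s : ℕ) (v x : List ℕ), LetterBalanced k a v → x <+ blockWord k b s m → x <+ v →
      b * (k * x.length) ≤ b * v.length + k * a * (m + s % b + b) := by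
  induction m using Nat.strong_induction_on with
  | _ m ih =>
    intro s v x hv hx hxv
    by_cases hm : s % b + m ≤ b
    · rw [blockWord_eq_replicate hm] at hx
      nlinarith [Nat.mul_le_mul_left b (hv.length_le_of_sublist_replicate hx hxv),
        Nat.zero_le (k * a * (m + s % b))]
    · have hs := Nat.mod_lt s hb
      obtain ⟨j, hj⟩ : ∃ j, s % b + j = b := ⟨b - s % b, by omega⟩
      obtain ⟨m', rfl⟩ : ∃ m', m = j + m' := ⟨m - j, by omega⟩
      rw [blockWord_add, blockWord_eq_replicate hj.le] at hx
      obtain ⟨x1, x2, rfl, hx1, hx2⟩ := List.sublist_append_iff.1 hx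
      obtain ⟨v1, v2, rfl, hv1, hv2⟩ := List.append_sublist_iff.1 hxv
      have hmod : (s + j) % b = 0 := by
        have hd := Nat.div_add_mod s b
        have : s + j = b * (s / b + 1) := by rw [Nat.mul_succ]; omega
        rw [this, Nat.mul_mod_right]
      have h2 := ih m' (by omega) (s + j) v2 x2 (hv.factor (List.suffix_append _ _).isInfix) hx2 hv2
      have h1 := Nat.mul_le_mul_left b <|
        (hv.factor (List.prefix_append v1 v2).isInfix).length_le_of_sublist_replicate hx1 hv1
      rw [hmod] at h2
      have h3 : j + m' + s % b + b = (m' + 0 + b) + b := by omega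
      rw [h3, List.length_append, List.length_append]
      nlinarith

theorem coarse_blockWord {k b : ℕ} (hb : 0 < b) (s m : ℕ) : Coarse k b (blockWord k b s m) := by
  intro a p v x hp hv hxp hxv
  obtain ⟨s, m, rfl⟩ := exists_eq_blockWord_of_isInfix hp
  refine (length_le_of_sublist_blockWord hb m s v x hv hxp hxv).trans ?_
  rw [length_blockWord]
  have := Nat.mod_lt s hb
  exact Nat.add_le_add_left (Nat.mul_le_mul_left _ (by omega)) _

/-- The total length of a list of tagged words, each weighted by a function of its tag. -/
def weightedLength (f : ℕ → ℕ) (P : List (ℕ × List ℕ)) : ℕ :=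
  (P.map fun p => f p.1 * p.2.length).sum

/-- If each common subsequence of factors of a piece of `P` and a piece of `Q` is short, then so is
each common subsequence of the concatenations of the pieces of `P` and of `Q`. -/
theorem length_le_weightedLength {f : ℕ → ℕ} {D C : ℕ} (N : ℕ) :
    ∀ P Q : List (ℕ × List ℕ), P.length + Q.length = N →
    (∀ a ∈ P, ∀ b ∈ Q, ∀ p q x : List ℕ, p <:+: a.2 → q <:+: b.2 → x <+ p → x <+ q →
      D * x.length ≤ f a.1 * p.length + f b.1 * q.length + C) →
    ∀ x : List ℕ, x <+ (P.map Prod.snd).flatten → x <+ (Q.map Prod.snd).flatten →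
      D * x.length ≤ weightedLength f P + weightedLength f Q + N * C := by
  induction N with
  | zero =>
    intro P Q hN _ x hx _
    obtain rfl : P = [] := List.eq_nil_of_length_eq_zero (by omega)
    obtain rfl : x = [] := by simpa using hx
    simp
  | succ N ih =>
    intro P Q hN H x hxP hxQ
    match P, Q with
    | [], Q =>
      obtain rfl : x = [] := by simpa using hxP
      simp
    | P, [] =>
      obtain rfl : x = [] := by simpa using hxQ
      simp
    | (i, p) :: P, (j, q) :: Q =>
      simp only [List.map_cons, List.flatten_cons] at hxP hxQ
      obtain ⟨x1, x2, rfl, hx1, hx2⟩ := List.sublist_append_iff.1 hxP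
      obtain ⟨y1, y2, hxy, hy1, hy2⟩ := List.sublist_append_iff.1 hxQ
      simp only [List.length_cons] at hN
      rcases List.append_eq_append_iff.1 hxy with ⟨z, rfl, rfl⟩ | ⟨z, rfl, rfl⟩
      · obtain ⟨q1, q2, rfl, hq1, hq2⟩ := List.append_sublist_iff.1 hy1
        have h1 := H (i, p) (by simp) (j, q1 ++ q2) (by simp) p q1 x1 List.infix_rfl
          (List.prefix_append _ _).isInfix hx1 hq1
        have h2 := ih P ((j, q2) :: Q) (by simp; omega) (by
          intro a ha b hb p' q' x hp hq
          rcases List.mem_cons.1 hb with rfl | hb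
          · exact H a (by simp [ha]) (j, q1 ++ q2) (by simp) p' q' x hp
              (hq.trans (List.suffix_append _ _).isInfix)
          · exact H a (by simp [ha]) b (by simp [hb]) p' q' x hp hq)
          (z ++ y2) hx2 (by simpa using hq2.append hy2)
        simp only [weightedLength, List.map_cons, List.sum_cons, List.length_append] at *
        nlinarith
      · obtain ⟨p1, p2, rfl, hp1, hp2⟩ := List.append_sublist_iff.1 hx1
        have h1 := H (i, p1 ++ p2) (by simp) (j, q) (by simp) p1 q y1
          (List.prefix_append _ _).isInfix List.infix_rfl hp1 hy1
        have h2 := ih ((i, p2) :: P) Q (by simp; omega) (by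
          intro a ha b hb p' q' x hp hq
          rcases List.mem_cons.1 ha with rfl | ha
          · exact H (i, p1 ++ p2) (by simp) b (by simp [hb]) p' q' x
              (hp.trans (List.suffix_append _ _).isInfix) hq
          · exact H a (by simp [ha]) b (by simp [hb]) p' q' x hp hq)
          (z ++ x2) (by simpa using hp2.append hx2) hy2
        simp only [weightedLength, List.map_cons, List.sum_cons, List.length_append] at *
        nlinarith

theorem exists_split_pieces {P : List (ℕ × List ℕ)} (hP : P ≠ []) {x y : List ℕ}
    (h : (P.map Prod.snd).flatten = x ++ y) :
    ∃ P₁ i p₁ p₂ P₂, P = P₁ ++ (i, p₁ ++ p₂) :: P₂ ∧ x = (P₁.map Prod.snd).flatten ++ p₁ ∧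
      y = p₂ ++ (P₂.map Prod.snd).flatten := by
  induction P generalizing x with
  | nil => exact absurd rfl hP
  | cons a P ih =>
    obtain ⟨i, p⟩ := a
    rw [List.map_cons, List.flatten_cons] at h
    rcases List.append_eq_append_iff.1 h with ⟨z, rfl, hz⟩ | ⟨z, rfl, rfl⟩
    · by_cases hP' : P = []
      · subst hP'
        obtain ⟨rfl, rfl⟩ : z = [] ∧ y = [] := by simpa using hz
        exact ⟨[], i, p, [], [], by simp, by simp, by simp⟩
      · obtain ⟨P₁, j, p₁, p₂, P₂, rfl, rfl, rfl⟩ := ih hP' hz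
        exact ⟨(i, p) :: P₁, j, p₁, p₂, P₂, by simp, by simp, rfl⟩
    · exact ⟨[], i, x, z, P, by simp, by simp, rfl⟩

theorem exists_half_of_palindrome {u v : List ℕ} (hvu : v <+ u) (hv : v.reverse = v) :
    ∃ A B x, u = A ++ B ∧ x <+ A ∧ x <+ B.reverse ∧ v.length ≤ 2 * x.length + 1 := by
  have hsplit : v = v.take (v.length / 2) ++ v.drop (v.length / 2) := by simp
  rw [hsplit] at hvu
  obtain ⟨A, B, rfl, hA, hB⟩ := List.append_sublist_iff.1 hvu
  refine ⟨A, B, v.take (v.length / 2), rfl, hA, ?_, by rw [List.length_take]; omega⟩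
  refine List.Sublist.trans ?_ hB.reverse
  rw [List.reverse_drop, hv]
  exact List.take_sublist_take_left (by omega)

theorem weightedLength_append (f : ℕ → ℕ) (P Q : List (ℕ × List ℕ)) :
    weightedLength f (P ++ Q) = weightedLength f P + weightedLength f Q := by
  simp [weightedLength]

theorem weightedLength_cons (f : ℕ → ℕ) (a : ℕ × List ℕ) (P : List (ℕ × List ℕ)) :
    weightedLength f (a :: P) = f a.1 * a.2.length + weightedLength f P := by
  simp [weightedLength]

theorem weightedLength_nil (f : ℕ → ℕ) : weightedLength f [] = 0 := rfl

/-- Cutting a circular concatenation of pieces with distinct tags into two arcs `A` and `B` cuts at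
most two pieces, with tags `j` and `l`. -/
theorem exists_pieces_of_rotate_eq_append {P : List (ℕ × List ℕ)} (hP : P ≠ [])
    (hnd : (P.map Prod.fst).Nodup) {r : ℕ} {A B : List ℕ}
    (h : (P.map Prod.snd).flatten.rotate r = A ++ B) :
    ∃ PA PB j l, A = (PA.map Prod.snd).flatten ∧ B = (PB.map Prod.snd).flatten ∧
      PA.length + PB.length = P.length + 2 ∧
      (∀ f, weightedLength f PA + weightedLength f PB = weightedLength f P) ∧
      (∀ a ∈ PA ++ PB, ∃ c ∈ P, a.1 = c.1 ∧ a.2 <:+: c.2) ∧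
      ∀ a ∈ PA, ∀ b ∈ PB, a.1 = b.1 → a.1 = j ∨ a.1 = l := by
  obtain ⟨X, Y, hXY, hYX⟩ : ∃ X Y, (P.map Prod.snd).flatten = X ++ Y ∧ A ++ B = Y ++ X := by
    refine ⟨_, _, (List.take_append_drop (r % (P.map Prod.snd).flatten.length) _).symm, ?_⟩
    rw [← h, ← List.rotate_mod]
    by_cases h0 : (P.map Prod.snd).flatten.length = 0
    · rw [List.eq_nil_of_length_eq_zero h0]; simp
    · exact List.rotate_eq_drop_append_take (Nat.mod_lt _ (Nat.pos_of_ne_zero h0)).le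
  obtain ⟨P₁, j, p₁, p₂, P₂, rfl, rfl, rfl⟩ := exists_split_pieces hP hXY
  set U : List (ℕ × List ℕ) := (j, p₂) :: P₂ ++ P₁ ++ [(j, p₁)] with hU
  have hUflat : (U.map Prod.snd).flatten = A ++ B := by rw [hYX]; simp [hU]
  have hUpair : U.Pairwise fun a b => a.1 = b.1 → a.1 = j := by
    have hnd' : (P₂ ++ P₁).Pairwise fun a b => a.1 ≠ b.1 := by
      rw [← List.pairwise_map (f := Prod.fst) (R := (· ≠ ·))]
      exact (List.perm_append_comm.map Prod.fst).nodup (l := (P₁ ++ P₂).map Prod.fst)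
        (hnd.sublist (by simp))
    simp only [hU, List.cons_append, List.pairwise_cons, List.pairwise_append (l₂ := [(j, p₁)])]
    refine ⟨by simp, hnd'.imp fun hne he => absurd he hne, by simp, ?_⟩
    intro a _ b hb he
    rw [he, List.mem_singleton.1 hb]
  have hUfactor : ∀ a ∈ U, ∃ c ∈ P₁ ++ (j, p₁ ++ p₂) :: P₂, a.1 = c.1 ∧ a.2 <:+: c.2 := by
    intro a ha
    simp only [hU, List.mem_append, List.mem_cons, List.not_mem_nil, or_false] at ha
    rcases ha with ((rfl | ha) | ha) | rfl
    · exact ⟨(j, p₁ ++ p₂), by simp, rfl, (List.suffix_append _ _).isInfix⟩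
    · exact ⟨a, by simp [ha], rfl, List.infix_rfl⟩
    · exact ⟨a, by simp [ha], rfl, List.infix_rfl⟩
    · exact ⟨(j, p₁ ++ p₂), by simp, rfl, (List.prefix_append _ _).isInfix⟩
  have hUlen : U.length = (P₁ ++ (j, p₁ ++ p₂) :: P₂).length + 1 := by
    simp [hU]; omega
  have hUweight : ∀ f, weightedLength f U = weightedLength f (P₁ ++ (j, p₁ ++ p₂) :: P₂) := by
    intro f
    simp only [hU, List.cons_append, weightedLength_append, weightedLength_cons,
      weightedLength_nil, List.length_append]
    ring
  clear_value U
  have hUne : U ≠ [] := by rintro rfl; simp at hUlen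
  obtain ⟨Q₁, l, q₁, q₂, Q₂, rfl, rfl, rfl⟩ := exists_split_pieces hUne hUflat
  refine ⟨Q₁ ++ [(l, q₁)], (l, q₂) :: Q₂, j, l, by simp, by simp, ?_, ?_, ?_, ?_⟩
  · rw [List.length_append, List.length_cons] at hUlen
    rw [List.length_append, List.length_cons, List.length_cons, List.length_nil]
    omega
  · intro f
    rw [← hUweight]
    simp only [weightedLength_append, weightedLength_cons, weightedLength_nil, List.length_append]
    ring
  · intro a ha
    simp only [List.mem_append, List.mem_cons, List.not_mem_nil, or_false] at ha
    have hcut := hUfactor (l, q₁ ++ q₂) (by simp)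
    rcases ha with (ha | rfl) | rfl | ha
    · exact hUfactor a (by simp [ha])
    · obtain ⟨c, hc, h1, h2⟩ := hcut
      exact ⟨c, hc, h1, (List.prefix_append _ _).isInfix.trans h2⟩
    · obtain ⟨c, hc, h1, h2⟩ := hcut
      exact ⟨c, hc, h1, (List.suffix_append _ _).isInfix.trans h2⟩
    · exact hUfactor a (by simp [ha])
  · intro a ha b hb he
    rw [List.pairwise_append] at hUpair
    rcases List.mem_append.1 ha with ha | ha
    · rcases List.mem_cons.1 hb with rfl | hb
      · exact Or.inr he
      · exact Or.inl (hUpair.2.2 a ha b (by simp [hb]) he)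
    · rw [List.mem_singleton.1 ha]; exact Or.inr rfl

theorem length_le_of_letterBalanced_of_coarse {k a b R M : ℕ} {p q x : List ℕ} (hb : 0 < b)
    (hab : a * R ≤ b) (haM : a ≤ M) (hp : LetterBalanced k a p) (hq : Coarse k b q)
    (hxp : x <+ p) (hxq : x <+ q) :
    (k + 1) * R * x.length ≤ (R + k) * p.length + (R + k) * q.length + 2 * k * R * M := by
  have h1 := hq a q p x List.infix_rfl hp hxq hxp
  have h2 : R * (k * x.length) ≤ R * p.length + k * q.length + 2 * k * R * a := by
    refine Nat.le_of_mul_le_mul_left ?_ hb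
    calc b * (R * (k * x.length)) = R * (b * (k * x.length)) := by ring
      _ ≤ R * (b * p.length + k * a * (q.length + 2 * b)) := Nat.mul_le_mul_left _ h1
      _ = b * (R * p.length) + (a * R) * (k * q.length) + b * (2 * k * R * a) := by ring
      _ ≤ b * (R * p.length) + b * (k * q.length) + b * (2 * k * R * a) := by gcongr
      _ = _ := by ring
  have h3 := Nat.mul_le_mul_left R hxq.length_le
  have h4 := Nat.mul_le_mul_left (2 * k * R) haM
  nlinarith [Nat.zero_le (k * p.length)]

/-- The tagged pieces of the circular word: piece `i` has blocks of length `T ^ i`. -/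
def circularPieces (k T : ℕ) : List (ℕ × List ℕ) :=
  (List.range T).map fun i => (i, blockWord k (T ^ i) 0 (k * (T ^ T * T)))

theorem weightedLength_circularPieces (f : ℕ → ℕ) (k T : ℕ) :
    weightedLength f (circularPieces k T) =
      (∑ i ∈ Finset.range T, f i) * (k * (T ^ T * T)) := by
  rw [Finset.sum_mul]
  simp [weightedLength, circularPieces, Function.comp_def, length_blockWord, Finset.sum_range,
    ← List.sum_ofFn, List.ofFn_eq_map, List.map_map, ← List.map_coe_finRange_eq_range]

theorem map_fst_circularPieces (k T : ℕ) : (circularPieces k T).map Prod.fst = List.range T := by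
  simp [circularPieces, Function.comp_def]

theorem length_flatten_circularPieces (k T : ℕ) :
    ((circularPieces k T).map Prod.snd).flatten.length = k * (T * (T ^ T * T)) := by
  simp [circularPieces, Function.comp_def, List.length_flatten, length_blockWord]
  ring

theorem count_flatten_circularPieces {k T c : ℕ} (hT : 0 < T) (hc : c < k) :
    ((circularPieces k T).map Prod.snd).flatten.count c = T * (T ^ T * T) := by
  have h : ∀ i ∈ List.range T,
      (blockWord k (T ^ i) 0 (k * (T ^ T * T))).count c = T ^ T * T := by
    intro i hi
    obtain ⟨e, he⟩ := Nat.exists_eq_add_of_le (List.mem_range.1 hi).le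
    have h1 : T ^ T * T = T ^ i * (T ^ e * T) := by
      rw [← mul_assoc, ← pow_add, ← he]
    rw [h1, ← mul_assoc, count_blockWord_mul (Nat.pow_pos hT), if_pos hc]
  rw [List.count_flatten, circularPieces, List.map_map, List.map_map]
  simp only [Function.comp_def]
  rw [List.map_congr_left h]
  simp

/-- A common subsequence of an arc of the circular word and the reversed complementary arc is
short. -/
theorem length_le_of_arcs {k T r : ℕ} (hk : 0 < k) (hT : 0 < T) {A B x : List ℕ}
    (h : ((circularPieces k T).map Prod.snd).flatten.rotate r = A ++ B)
    (hxA : x <+ A) (hxB : x <+ B.reverse) :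
    (k + 1) * T * x.length ≤
      (T + k) * (T + 2 * k) * (k * (T ^ T * T)) + (T + 2) * (2 * k * T * T ^ T) := by
  have hne : circularPieces k T ≠ [] := by
    simp [circularPieces, hT.ne']
  obtain ⟨PA, PB, j, l, rfl, rfl, hlen, hweight, hfactor, htags⟩ :=
    exists_pieces_of_rotate_eq_append hne
      (by rw [map_fst_circularPieces]; exact List.nodup_range) h
  have hgood : ∀ a ∈ PA ++ PB,
      a.1 < T ∧ ∃ s m, a.2 = blockWord k (T ^ a.1) s m := by
    intro a ha
    obtain ⟨c, hc, h1, h2⟩ := hfactor a ha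
    simp only [circularPieces, List.mem_map, List.mem_range] at hc
    obtain ⟨i, hi, rfl⟩ := hc
    rw [h1]
    exact ⟨hi, exists_eq_blockWord_of_isInfix h2⟩
  set f : ℕ → ℕ := fun i =>
    (T + k) * (1 + k * (if i = j then 1 else 0) + k * (if i = l then 1 else 0))
    with hf
  set PB' : List (ℕ × List ℕ) := (PB.map fun b => (b.1, b.2.reverse)).reverse with hPB'
  have hPB'flat : (PB'.map Prod.snd).flatten = ((PB.map Prod.snd).flatten).reverse := by
    rw [List.reverse_flatten, hPB', List.map_reverse, List.map_map, List.map_map]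
    rfl
  have hPB'weight : weightedLength f PB' = weightedLength f PB := by
    simp [weightedLength, hPB', List.sum_reverse, Function.comp_def]
  have hf1 : ∀ i, T + k ≤ f i := fun i => Nat.le_mul_of_pos_right _ (by omega)
  have hf2 : ∀ i, i = j ∨ i = l → (k + 1) * T ≤ f i := by
    intro i hi
    have h1 : k + 1 ≤ 1 + k * (if i = j then 1 else 0) + k * (if i = l then 1 else 0) := by
      rcases hi with rfl | rfl <;> grind
    calc (k + 1) * T ≤ (T + k) * (k + 1) := by nlinarith
      _ ≤ f i := Nat.mul_le_mul_left _ h1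
  have key := length_le_weightedLength (f := f) (D := (k + 1) * T) (C := 2 * k * T * T ^ T)
    (T + 2) PA PB' ?_ ?_ x hxA (hPB'flat ▸ hxB)
  · rw [hPB'weight, hweight, weightedLength_circularPieces] at key
    refine key.trans ?_
    gcongr
    rw [hf, ← Finset.mul_sum]
    gcongr
    rw [Finset.sum_add_distrib, Finset.sum_add_distrib, ← Finset.mul_sum, ← Finset.mul_sum,
      Finset.sum_ite_eq', Finset.sum_ite_eq', Finset.sum_const, Finset.card_range]
    have : ∀ m, k * (if m ∈ Finset.range T then 1 else 0) ≤ k := by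
      intro m; split_ifs <;> simp
    have h1 := this j
    have h2 := this l
    simp only [smul_eq_mul]
    omega
  · rw [hPB', List.length_reverse, List.length_map, hlen]
    simp [circularPieces]
  · intro a ha b hb p q y hp hq hyp hyq
    simp only [hPB', List.mem_reverse, List.mem_map] at hb
    obtain ⟨b, hb, rfl⟩ := hb
    obtain ⟨haT, sa, ma, hasw⟩ := hgood a (by simp [ha])
    obtain ⟨hbT, sb, mb, hbsw⟩ := hgood b (by simp [hb])
    have hpos : ∀ i, 0 < T ^ i := fun i => Nat.pow_pos hT
    have hpow : ∀ {i i'}, i < i' → T ^ i * T ≤ T ^ i' := fun hi => by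
      rw [← pow_succ]; exact Nat.pow_le_pow_right hT hi
    have hmax : ∀ {i}, i < T → T ^ i ≤ T ^ T := fun hi => Nat.pow_le_pow_right hT hi.le
    have hfa := Nat.mul_le_mul_right p.length (hf1 a.1)
    have hfb := Nat.mul_le_mul_right q.length (hf1 b.1)
    rcases lt_trichotomy a.1 b.1 with hab | hab | hab
    · have hpB : LetterBalanced k (T ^ a.1) p :=
        (hasw ▸ letterBalanced_blockWord hk (hpos _) sa ma :
          LetterBalanced k (T ^ a.1) a.2).factor hp
      have hqC : Coarse k (T ^ b.1) q :=
        (hbsw ▸ (coarse_blockWord (hpos _) sb mb).reverse : Coarse k (T ^ b.1) b.2.reverse).factor hq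
      have := length_le_of_letterBalanced_of_coarse (hpos _) (hpow hab) (hmax haT) hpB hqC hyp hyq
      dsimp only
      omega
    · have h1 := Nat.mul_le_mul (hf2 a.1 (htags a ha b hb hab)) hyp.length_le
      dsimp only
      omega
    · have hpC : Coarse k (T ^ a.1) p :=
        (hasw ▸ coarse_blockWord (hpos _) sa ma : Coarse k (T ^ a.1) a.2).factor hp
      have hqB : LetterBalanced k (T ^ b.1) q :=
        (hbsw ▸ (letterBalanced_blockWord hk (hpos _) sb mb).reverse :
          LetterBalanced k (T ^ b.1) b.2.reverse).factor hq
      have := length_le_of_letterBalanced_of_coarse (hpos _) (hpow hab) (hmax hbT) hqB hpC hyq hyp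
      dsimp only
      omega

/-- The final estimate, for `x` half the length `v` of a palindrome. -/
theorem length_le_of_half_length_le {T M k ε x v : ℝ} (hT : 1 ≤ T) (hM : 1 ≤ M) (hk : 2 ≤ k)
    (hε : 4 * k ^ 2 + 6 * k + 13 ≤ T * ε)
    (hx : (k + 1) * T * x ≤ (T + k) * (T + 2 * k) * (k * (M * T)) + (T + 2) * (2 * k * T * M))
    (hv : v ≤ 2 * x + 1) :
    v ≤ (2 / (k + 1) + ε) * (k * (T * (M * T))) := by
  have hk1 : 0 < k + 1 := by linarith
  have hkM : 1 ≤ k * M := by nlinarith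
  have hx' : (k + 1) * x ≤ ((T + k) * (T + 2 * k) + 2 * (T + 2)) * (k * M) := by
    refine le_of_mul_le_mul_left ?_ (show 0 < T by linarith)
    linarith
  have hpoly : 2 * ((T + k) * (T + 2 * k) + 2 * (T + 2)) + (k + 1) ≤
      2 * T ^ 2 + (k + 1) * ((4 * k ^ 2 + 6 * k + 13) * T) := by
    nlinarith [mul_nonneg (show 0 ≤ k by linarith) (show 0 ≤ T - 1 by linarith),
      mul_nonneg (sq_nonneg k) (show 0 ≤ T - 1 by linarith),
      mul_nonneg (pow_nonneg (show 0 ≤ k by linarith) 3) (show 0 ≤ T by linarith)]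
  have hmain : (k + 1) * v ≤ (2 + (k + 1) * ε) * (k * (T * (M * T))) := by
    calc (k + 1) * v ≤ (k + 1) * (2 * x + 1) := by gcongr
      _ ≤ (2 * ((T + k) * (T + 2 * k) + 2 * (T + 2)) + (k + 1)) * (k * M) := by nlinarith
      _ ≤ (2 * T ^ 2 + (k + 1) * ((4 * k ^ 2 + 6 * k + 13) * T)) * (k * M) := by gcongr
      _ ≤ (2 * T ^ 2 + (k + 1) * ((T * ε) * T)) * (k * M) := by gcongr
      _ = _ := by ring
  refine le_of_mul_le_mul_left (hmain.trans_eq ?_) hk1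
  field_simp

/-- **Theorem 1, palindromic part.** For every `k ≥ 2` and `ε > 0`, there is a
circular word over `{0, …, k-1}` with each letter occurring exactly `n` times (length `k·n`)
such that every palindromic subsequence of every rotation has length at most
`(2/(k+1) + ε)·k·n`. -/
theorem palindromic_subseq_upper_bound (k : ℕ) (hk : 2 ≤ k) (ε : ℝ) (hε : 0 < ε) :
    ∃ (n : ℕ), 0 < n ∧ ∃ w : List ℕ,
      w.length = k * n ∧ (∀ a < k, w.count a = n) ∧
      ∀ (i : ℕ) (v : List ℕ), v.Sublist (w.rotate i) → v.reverse = v →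
        (v.length : ℝ) ≤ (2 / (k + 1) + ε) * (k * n) := by
  obtain ⟨T, hT⟩ := exists_nat_gt ((4 * k ^ 2 + 6 * k + 13) / ε)
  have hT0 : 0 < T := by
    have : (0 : ℝ) < T := lt_of_le_of_lt (by positivity) hT
    exact_mod_cast this
  refine ⟨T * (T ^ T * T), by positivity, ((circularPieces k T).map Prod.snd).flatten,
    length_flatten_circularPieces k T, fun a ha => count_flatten_circularPieces hT0 ha, ?_⟩
  intro i v hv hpal
  obtain ⟨A, B, x, hAB, hxA, hxB, hlen⟩ := exists_half_of_palindrome hv hpal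
  have hx := length_le_of_arcs (by omega) hT0 hAB hxA hxB
  have hM : 0 < T ^ T := Nat.pow_pos hT0
  rw [div_lt_iff₀ hε] at hT
  generalize T ^ T = M at hx hM
  have hx' : ((k : ℝ) + 1) * T * x.length ≤
      (T + k) * (T + 2 * k) * (k * (M * T)) + (T + 2) * (2 * k * T * M) := by exact_mod_cast hx
  have hlen' : (v.length : ℝ) ≤ 2 * x.length + 1 := by exact_mod_cast hlen
  have hT1 : (1 : ℝ) ≤ T := by exact_mod_cast hT0
  have hM1 : (1 : ℝ) ≤ M := by exact_mod_cast hM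
  have hk2 : (2 : ℝ) ≤ k := by exact_mod_cast hk
  push_cast
  exact length_le_of_half_length_le hT1 hM1 hk2 hT.le hx' hlen'
end
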